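/- Let (μ_n)_{n∈ℕ} be a uniformly tight sequence of finite signed Borel measures on X×Y (for every ε > 0 there is a compact Z_ε ⊆ X×Y with |μ_n|(X×Y ∖ Z_ε) < ε for all n) such that sup_{n} |μ_n|(X×Y) < ∞, and let (f_n)_{n∈ℕ} ⊂ H converge in H to some f₀ ∈ H. Then lim_{n→∞} sup_{h∈H, ‖h‖_H ≤ 1} ‖ ∫ L''_{f_n} h Φ dμ_n − ∫ L''_{f₀} h Φ dμ_n ‖_H = 0. -/

import Mathlib

open MeasureTheory Filter Classical
open scoped ENNReal Topology RealInnerProductSpace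

/-- The Bochner integral of a vector-valued function with respect to a finite signed
measure `μ`, defined as `∫ f dμ⁺ - ∫ f dμ⁻` via the Jordan decomposition of `μ`. -/
noncomputable def sintegral {α : Type*} [MeasurableSpace α] {E : Type*}
    [NormedAddCommGroup E] [NormedSpace ℝ E] (μ : SignedMeasure α) (f : α → E) : E :=
  (∫ a, f a ∂μ.toJordanDecomposition.posPart) - ∫ a, f a ∂μ.toJordanDecomposition.negPart

lemma svm_aux_null {α : Type*} [MeasurableSpace α] (μ : SignedMeasure α) (S : Set α)
    (hS : MeasurableSet S)
    (h : ∀ A : Set α, MeasurableSet A → A ⊆ Sᶜ → μ A = 0) :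
    μ.toJordanDecomposition.posPart Sᶜ = 0 ∧ μ.toJordanDecomposition.negPart Sᶜ = 0 := by
  obtain ⟨i, hi₁, hi₂, hi₃, hp, hn⟩ := μ.toJordanDecomposition_spec
  have h1 : μ (i ∩ Sᶜ) = 0 := h _ (hi₁.inter hS.compl) Set.inter_subset_right
  have h2 : μ (iᶜ ∩ Sᶜ) = 0 := h _ (hi₁.compl.inter hS.compl) Set.inter_subset_right
  constructor
  · rw [hp, SignedMeasure.toMeasureOfZeroLE_apply _ _ _ hS.compl, ENNReal.coe_eq_zero]
    exact NNReal.eq h1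
  · rw [hn, SignedMeasure.toMeasureOfLEZero_apply _ _ _ hS.compl, ENNReal.coe_eq_zero]
    refine NNReal.eq ?_
    change -μ (iᶜ ∩ Sᶜ) = 0
    rw [h2, neg_zero]

lemma svm_aux_bound {α : Type*} [MeasurableSpace α] [TopologicalSpace α]
    [OpensMeasurableSpace α] [TopologicalSpace.PseudoMetrizableSpace α]
    [SecondCountableTopology α]
    {E : Type*} [NormedAddCommGroup E] [NormedSpace ℝ E]
    (ν : Measure α) [IsFiniteMeasure ν] (S Z : Set α)
    (hS : MeasurableSet S) (hZ : MeasurableSet Z) (h0 : ν Sᶜ = 0)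
    (F G : α → E) (hF : ContinuousOn F S) (hG : ContinuousOn G S)
    (B D δ C η : ℝ) (hC : 0 ≤ C) (hη : 0 ≤ η) (hδ : 0 ≤ δ) (hD : 0 ≤ D)
    (hFB : ∀ z ∈ S, ‖F z‖ ≤ B) (hGB : ∀ z ∈ S, ‖G z‖ ≤ B)
    (hFG : ∀ z ∈ S, ‖F z - G z‖ ≤ D) (hFGZ : ∀ z ∈ Z, ‖F z - G z‖ ≤ δ)
    (hν : ν Set.univ ≤ ENNReal.ofReal C) (hνZ : ν (S \ Z) ≤ ENNReal.ofReal η) :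
    ‖(∫ z, F z ∂ν) - ∫ z, G z ∂ν‖ ≤ δ * C + D * η := by
  have hae : ∀ᵐ z ∂ν, z ∈ S := h0
  have hres : ν.restrict S = ν := Measure.restrict_eq_self_of_ae_mem hae
  have hint : ∀ F : α → E, ContinuousOn F S → (∀ z ∈ S, ‖F z‖ ≤ B) → Integrable F ν := by
    intro F hF hFB
    have h1 : AEStronglyMeasurable F ν := by
      have := hF.aestronglyMeasurable (μ := ν) hS
      rwa [hres] at this
    exact Integrable.of_bound h1 B (hae.mono hFB)
  rw [← integral_sub (hint F hF hFB) (hint G hG hGB)]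
  have hb : Integrable (fun z => δ + (S \ Z).indicator (fun _ => D) z) ν :=
    (integrable_const _).add ((integrable_const _).indicator (hS.diff hZ))
  refine (norm_integral_le_of_norm_le hb (hae.mono fun z hz => ?_)).trans ?_
  · by_cases hzZ : z ∈ Z
    · simpa [hzZ] using hFGZ z hzZ
    · have hm : z ∈ S \ Z := ⟨hz, hzZ⟩
      rw [Set.indicator_of_mem hm]
      linarith [hFG z hz]
  · rw [integral_add (integrable_const _) ((integrable_const _).indicator (hS.diff hZ)),
      integral_indicator (hS.diff hZ), integral_const, setIntegral_const, smul_eq_mul,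
      smul_eq_mul]
    have e1 : ν.real Set.univ ≤ C := ENNReal.toReal_le_of_le_ofReal hC hν
    have e2 : ν.real (S \ Z) ≤ η := ENNReal.toReal_le_of_le_ofReal hη hνZ
    have := mul_le_mul_of_nonneg_left e1 hδ
    have := mul_le_mul_of_nonneg_left e2 hD
    linarith

/-- **Uniform continuity of `f ↦ ∫ L''_f h Φ dμ_n`** (Lemma 4 of the paper).
For a uniformly tight sequence of finite signed measures `μ_n` on `X × Y` with uniformly
bounded total variation, and `f_n → f₀` in `H`,
`sup_{‖h‖ ≤ 1} ‖∫ L''_{f_n} h Φ dμ_n - ∫ L''_{f₀} h Φ dμ_n‖ → 0`. -/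
theorem svm_second_derivative_uniform_convergence
    (d : ℕ) (X : Set (EuclideanSpace ℝ (Fin d))) [CompactSpace X]
    (Y : Set ℝ) (hY : IsClosed Y)
    -- the separable RKHS `H` of a continuous bounded kernel, via its feature map `Φ`
    (H : Type) [NormedAddCommGroup H] [InnerProductSpace ℝ H] [CompleteSpace H]
    [TopologicalSpace.SeparableSpace H]
    (Φ : EuclideanSpace ℝ (Fin d) → H)
    (hΦcont : ContinuousOn Φ X)
    (κ : ℝ) (hΦbdd : ∀ x ∈ X, ‖Φ x‖ ≤ κ)
    -- the loss function and its partial derivatives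
    (L L' L'' : EuclideanSpace ℝ (Fin d) → ℝ → ℝ → ℝ)
    (hLmeas : Measurable (fun q : (EuclideanSpace ℝ (Fin d) × ℝ) × ℝ => L q.1.1 q.1.2 q.2))
    (hLnonneg : ∀ x ∈ X, ∀ y ∈ Y, ∀ t : ℝ, 0 ≤ L x y t)
    (hL' : ∀ x ∈ X, ∀ y ∈ Y, ∀ t : ℝ, HasDerivAt (L x y) (L' x y t) t)
    (hL'' : ∀ x ∈ X, ∀ y ∈ Y, ∀ t : ℝ, HasDerivAt (L' x y) (L'' x y t) t)
    (hL'cont : ContinuousOn (fun q : (EuclideanSpace ℝ (Fin d) × ℝ) × ℝ => L' q.1.1 q.1.2 q.2)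
      ((X ×ˢ Y) ×ˢ (Set.univ : Set ℝ)))
    (hL''cont : ContinuousOn (fun q : (EuclideanSpace ℝ (Fin d) × ℝ) × ℝ => L'' q.1.1 q.1.2 q.2)
      ((X ×ˢ Y) ×ˢ (Set.univ : Set ℝ)))
    -- constant envelopes for `L''`
    (henv : ∀ a : ℝ, 0 < a → ∃ b'' : ℝ, 0 ≤ b'' ∧
      ∀ x ∈ X, ∀ y ∈ Y, ∀ t ∈ Set.Icc (-a) a, |L'' x y t| ≤ b'')
    -- a sequence of finite signed measures on `X × Y` …
    (μs : ℕ → SignedMeasure (EuclideanSpace ℝ (Fin d) × ℝ))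
    (hsupp : ∀ (n : ℕ) (A : Set (EuclideanSpace ℝ (Fin d) × ℝ)),
      MeasurableSet A → A ⊆ (X ×ˢ Y)ᶜ → μs n A = 0)
    -- … which is uniformly tight …
    (htight : ∀ ε : ℝ, 0 < ε → ∃ Z : Set (EuclideanSpace ℝ (Fin d) × ℝ),
      IsCompact Z ∧ Z ⊆ X ×ˢ Y ∧
      ∀ n, (μs n).totalVariation (X ×ˢ Y \ Z) < ENNReal.ofReal ε)
    -- … and has uniformly bounded total variation
    (C : ℝ) (hbdd : ∀ n, (μs n).totalVariation Set.univ ≤ ENNReal.ofReal C)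
    -- a convergent sequence in `H`
    (fs : ℕ → H) (f0 : H) (hfs : Tendsto (fun n => ‖fs n - f0‖) atTop (𝓝 0)) :
    -- conclusion: `sup_{‖h‖ ≤ 1} ‖∫ L''_{f_n} h Φ dμ_n - ∫ L''_{f₀} h Φ dμ_n‖ → 0`
    ∀ ε : ℝ, 0 < ε → ∃ N : ℕ, ∀ n ≥ N, ∀ h : H, ‖h‖ ≤ 1 →
      ‖sintegral (μs n) (fun z : EuclideanSpace ℝ (Fin d) × ℝ =>
          (L'' z.1 z.2 ⟪Φ z.1, fs n⟫ * ⟪Φ z.1, h⟫) • Φ z.1) -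
        sintegral (μs n) (fun z : EuclideanSpace ℝ (Fin d) × ℝ =>
          (L'' z.1 z.2 ⟪Φ z.1, f0⟫ * ⟪Φ z.1, h⟫) • Φ z.1)‖ ≤ ε := by
  intro ε hε
  have hXc : IsCompact X := isCompact_iff_compactSpace.2 inferInstance
  have hSm : MeasurableSet (X ×ˢ Y) := hXc.measurableSet.prod hY.measurableSet
  obtain ⟨K, hK0, hK⟩ : ∃ K : ℝ, 0 < K ∧ ∀ x ∈ X, ‖Φ x‖ ≤ K :=
    ⟨|κ| + 1, by positivity, fun x hx => (hΦbdd x hx).trans (by linarith [le_abs_self κ])⟩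
  obtain ⟨C', hC'0, hC'⟩ : ∃ C' : ℝ, 0 < C' ∧ C ≤ C' :=
    ⟨|C| + 1, by positivity, by linarith [le_abs_self C]⟩
  obtain ⟨a, ha⟩ : ∃ a : ℝ, a = K * (‖f0‖ + 1) := ⟨_, rfl⟩
  have ha0 : 0 < a := by rw [ha]; positivity
  obtain ⟨b, hb0, hb⟩ := henv a ha0
  have hin : ∀ x ∈ X, ∀ g : H, ‖g‖ ≤ ‖f0‖ + 1 → ⟪Φ x, g⟫ ∈ Set.Icc (-a) a := by
    intro x hx g hg
    rw [Set.mem_Icc, ← abs_le, ha]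
    exact (abs_real_inner_le_norm _ _).trans (mul_le_mul (hK x hx) hg (norm_nonneg _) hK0.le)
  obtain ⟨δ, hδ⟩ : ∃ δ : ℝ, δ = ε / (4 * K ^ 2 * C') := ⟨_, rfl⟩
  have hδ0 : 0 < δ := by rw [hδ]; positivity
  obtain ⟨η, hη⟩ : ∃ η : ℝ, η = ε / (8 * K ^ 2 * (b + 1)) := ⟨_, rfl⟩
  have hη0 : 0 < η := by rw [hη]; positivity
  obtain ⟨Z, hZc, hZS, hZ⟩ := htight η hη0
  have huc := (hZc.prod (isCompact_Icc (a := -a) (b := a))).uniformContinuousOn_of_continuous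
    (hL''cont.mono (Set.prod_mono hZS (Set.subset_univ _)))
  obtain ⟨r, hr0, hr⟩ := Metric.uniformContinuousOn_iff.1 huc δ hδ0
  have hev := (hfs.eventually (gt_mem_nhds (show (0 : ℝ) < min 1 (r / K) by positivity)))
  obtain ⟨N, hN⟩ := eventually_atTop.1 hev
  refine ⟨N, fun n hn h hh => ?_⟩
  have hn1 : ‖fs n - f0‖ < 1 := (hN n hn).trans_le (min_le_left _ _)
  have hn2 : ‖fs n - f0‖ < r / K := (hN n hn).trans_le (min_le_right _ _)
  have hfn : ‖fs n‖ ≤ ‖f0‖ + 1 := by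
    have := norm_le_norm_add_norm_sub f0 (fs n)
    rw [norm_sub_rev] at this
    linarith
  have hf0 : ‖f0‖ ≤ ‖f0‖ + 1 := by linarith
  have hcont : ∀ g : H, ContinuousOn (fun z : EuclideanSpace ℝ (Fin d) × ℝ =>
      (L'' z.1 z.2 ⟪Φ z.1, g⟫ * ⟪Φ z.1, h⟫) • Φ z.1) (X ×ˢ Y) := by
    intro g
    have c1 : ContinuousOn (fun z : EuclideanSpace ℝ (Fin d) × ℝ => Φ z.1) (X ×ˢ Y) :=
      hΦcont.comp continuousOn_fst (fun z hz => hz.1)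
    have c2 : ContinuousOn (fun z : EuclideanSpace ℝ (Fin d) × ℝ => ⟪Φ z.1, g⟫) (X ×ˢ Y) :=
      c1.inner continuousOn_const
    have c3 : ContinuousOn (fun z : EuclideanSpace ℝ (Fin d) × ℝ => ⟪Φ z.1, h⟫) (X ×ˢ Y) :=
      c1.inner continuousOn_const
    have c4 : ContinuousOn (fun z : EuclideanSpace ℝ (Fin d) × ℝ =>
        L'' z.1 z.2 ⟪Φ z.1, g⟫) (X ×ˢ Y) :=
      hL''cont.comp (f := fun z : EuclideanSpace ℝ (Fin d) × ℝ => (z, ⟪Φ z.1, g⟫))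
        (continuousOn_id.prodMk c2) (fun z hz => ⟨hz, Set.mem_univ _⟩)
    exact (c4.mul c3).smul c1
  have hsm : ∀ x ∈ X, ∀ s c : ℝ, |s| ≤ c → ‖(s * ⟪Φ x, h⟫) • Φ x‖ ≤ c * K ^ 2 := by
    intro x hx s c hs
    have hc : 0 ≤ c := (abs_nonneg _).trans hs
    have i1 : |⟪Φ x, h⟫| ≤ K := by
      calc |⟪Φ x, h⟫| ≤ ‖Φ x‖ * ‖h‖ := abs_real_inner_le_norm _ _
        _ ≤ K * 1 := mul_le_mul (hK x hx) hh (norm_nonneg _) hK0.le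
        _ = K := mul_one _
    rw [norm_smul, Real.norm_eq_abs, abs_mul]
    calc |s| * |⟪Φ x, h⟫| * ‖Φ x‖ ≤ c * K * K := by
          have := hK x hx
          gcongr
      _ = c * K ^ 2 := by ring
  have hbd : ∀ g : H, ‖g‖ ≤ ‖f0‖ + 1 → ∀ z ∈ X ×ˢ Y,
      ‖(L'' z.1 z.2 ⟪Φ z.1, g⟫ * ⟪Φ z.1, h⟫) • Φ z.1‖ ≤ b * K ^ 2 :=
    fun g hg z hz => hsm z.1 hz.1 _ _ (hb z.1 hz.1 z.2 hz.2 _ (hin z.1 hz.1 g hg))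
  have key : ∀ ν : Measure (EuclideanSpace ℝ (Fin d) × ℝ), IsFiniteMeasure ν →
      ν (X ×ˢ Y)ᶜ = 0 → ν ≤ (μs n).totalVariation →
      ‖(∫ z, (L'' z.1 z.2 ⟪Φ z.1, fs n⟫ * ⟪Φ z.1, h⟫) • Φ z.1 ∂ν) -
        ∫ z, (L'' z.1 z.2 ⟪Φ z.1, f0⟫ * ⟪Φ z.1, h⟫) • Φ z.1 ∂ν‖ ≤ ε / 2 := by
    intro ν hνf hν0 hνle
    refine (svm_aux_bound ν (X ×ˢ Y) Z hSm hZc.measurableSet hν0 _ _ (hcont _) (hcont _)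
      (b * K ^ 2) (2 * b * K ^ 2) (δ * K ^ 2) C' η hC'0.le hη0.le (by positivity)
      (by positivity) (hbd _ hfn) (hbd _ hf0) ?_ ?_ ?_ ?_).trans ?_
    · intro z hz
      refine (norm_sub_le _ _).trans ?_
      linarith [hbd _ hfn z hz, hbd _ hf0 z hz]
    · intro z hz
      have hx := (hZS hz).1
      rw [← sub_smul, ← sub_mul]
      refine hsm z.1 hx _ _ ?_
      have := hr (z, ⟪Φ z.1, fs n⟫) ⟨hz, hin _ hx _ hfn⟩ (z, ⟪Φ z.1, f0⟫)
        ⟨hz, hin _ hx _ hf0⟩ ?_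
      · rw [Real.dist_eq] at this
        exact this.le
      · rw [Prod.dist_eq, dist_self, Real.dist_eq, ← inner_sub_right]
        refine max_lt hr0 ((abs_real_inner_le_norm _ _).trans_lt ?_)
        calc ‖Φ z.1‖ * ‖fs n - f0‖ ≤ K * ‖fs n - f0‖ :=
              mul_le_mul_of_nonneg_right (hK _ hx) (norm_nonneg _)
          _ < K * (r / K) := mul_lt_mul_of_pos_left hn2 hK0
          _ = r := by field_simp
    · exact (hνle _).trans ((hbdd n).trans (ENNReal.ofReal_le_ofReal hC'))
    · exact (hνle _).trans (hZ n).le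
    · have e1 : δ * K ^ 2 * C' = ε / 4 := by
        rw [hδ]; field_simp
      have e2 : 2 * b * K ^ 2 * η ≤ ε / 4 := by
        have : 2 * (b + 1) * K ^ 2 * η = ε / 4 := by
          rw [hη]; field_simp; norm_num
        rw [← this]
        gcongr
        linarith
      linarith
  obtain ⟨p0, n0⟩ := svm_aux_null (μs n) (X ×ˢ Y) hSm (hsupp n)
  have kp := key _ inferInstance p0 (by
    unfold SignedMeasure.totalVariation; exact Measure.le_add_right le_rfl)
  have kn := key _ inferInstance n0 (by
    unfold SignedMeasure.totalVariation; exact Measure.le_add_left le_rfl)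
  unfold sintegral
  rw [sub_sub_sub_comm]
  refine (norm_sub_le _ _).trans ?_
  linarith
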